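/- arXiv:1709.00534 — 2 statements merged into one kernel-verified Lean document; each statement's English description precedes it below -/
import Mathlib

section
/- Let f(x) = x³ + P·x² + Q·x + R with P, Q, R ∈ ℂ, let Δ = P²Q² - 4Q³ - 4P³R + 18PQR - 27R² with Δ ≠ 0, and let s ∈ ℂ satisfy s² = Δ. Define a = (s - (9R - PQ))/(2s), b = (2Q² - 6PR)/(2s), c = (6Q - 2P²)/(2s), and d = 1 - a. Then for every root t of f, one has c·t + d ≠ 0 and (a·t + b)/(c·t + d) is also a root of f; that is, the Möbius map m(x) = (ax + b)/(cx + d) permutes the roots of f. -/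
/-- Given a root `t` of a monic cubic with nonzero discriminant `s ^ 2`, the other two roots `u`, `v`
can be ordered so that `s = (t - u) * (t - v) * (u - v)`. -/
theorem exists_roots_of_sq_eq_discr {K : Type*} [Field K] [NeZero (2 : K)] {P Q R s t : K}
    (hs : s ^ 2 = P ^ 2 * Q ^ 2 - 4 * Q ^ 3 - 4 * P ^ 3 * R + 18 * P * Q * R - 27 * R ^ 2)
    (hs0 : s ≠ 0) (ht : t ^ 3 + P * t ^ 2 + Q * t + R = 0) :
    ∃ u v : K, P = -(t + u + v) ∧ Q = t * u + t * v + u * v ∧ R = -(t * u * v) ∧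
      s = (t - u) * (t - v) * (u - v) := by
  have h2 : (2 : K) ≠ 0 := two_ne_zero
  have hR : R = -(t ^ 3 + P * t ^ 2 + Q * t) := by linear_combination ht
  have hfac : s ^ 2 = (3 * t ^ 2 + 2 * P * t + Q) ^ 2 *
      ((P + t) ^ 2 - 4 * (Q + t * (P + t))) := by
    rw [hs, hR]; ring
  have hF : 3 * t ^ 2 + 2 * P * t + Q ≠ 0 := by
    intro h
    rw [h] at hfac
    exact hs0 (by simpa using hfac)
  obtain ⟨w, hw⟩ : ∃ w, s = (3 * t ^ 2 + 2 * P * t + Q) * w :=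
    ⟨s / (3 * t ^ 2 + 2 * P * t + Q), (mul_div_cancel₀ _ hF).symm⟩
  have hw2 : w ^ 2 = (P + t) ^ 2 - 4 * (Q + t * (P + t)) := by
    apply mul_left_cancel₀ (pow_ne_zero 2 hF)
    rw [← hfac, hw]; ring
  obtain ⟨u, hu⟩ : ∃ u, 2 * u = -(P + t) + w := ⟨(-(P + t) + w) / 2, by field_simp⟩
  obtain rfl : w = 2 * u + P + t := by linear_combination -hu
  have hQ : Q = t * u + t * (-(P + t) - u) + u * (-(P + t) - u) := by
    apply mul_left_cancel₀ (mul_ne_zero h2 h2)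
    linear_combination hw2
  refine ⟨u, -(P + t) - u, by ring, hQ, ?_, ?_⟩
  · rw [hR, hQ]; ring
  · rw [hw, hQ]; ring

theorem stmt_9 (P Q R Δ s a b c d : ℂ)
    (hΔ : Δ = P ^ 2 * Q ^ 2 - 4 * Q ^ 3 - 4 * P ^ 3 * R + 18 * P * Q * R - 27 * R ^ 2)
    (hΔ0 : Δ ≠ 0)
    (hs : s ^ 2 = Δ)
    (ha : a = (s - (9 * R - P * Q)) / (2 * s))
    (hb : b = (2 * Q ^ 2 - 6 * P * R) / (2 * s))
    (hc : c = (6 * Q - 2 * P ^ 2) / (2 * s))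
    (hd : d = 1 - a) :
    ∀ t : ℂ, t ^ 3 + P * t ^ 2 + Q * t + R = 0 →
      c * t + d ≠ 0 ∧
      ((a * t + b) / (c * t + d)) ^ 3 + P * ((a * t + b) / (c * t + d)) ^ 2 +
        Q * ((a * t + b) / (c * t + d)) + R = 0 := by
  intro t ht
  have hs0 : s ≠ 0 := by
    rintro rfl
    exact hΔ0 (by simpa using hs.symm)
  obtain ⟨u, v, hP, hQ, hR, hsu⟩ := exists_roots_of_sq_eq_discr (hs.trans hΔ) hs0 ht
  have htuv : (t - u) * (t - v) ≠ 0 := fun h => hs0 (by rw [hsu, h, zero_mul])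
  have hden : c * t + d = -2 * ((t - u) * ((t - u) * (t - v))) / (2 * s) := by
    rw [hd, ha, hc]
    field_simp
    rw [hP, hQ, hR, hsu]
    ring
  have hnum : a * t + b = v * (c * t + d) := by
    rw [hd, ha, hb, hc]
    field_simp
    rw [hP, hQ, hR, hsu]
    ring
  have hden0 : c * t + d ≠ 0 := by
    rw [hden]
    exact div_ne_zero (mul_ne_zero (by norm_num) (mul_ne_zero (left_ne_zero_of_mul htuv) htuv))
      (mul_ne_zero two_ne_zero hs0)
  refine ⟨hden0, ?_⟩
  rw [hnum, mul_div_cancel_right₀ _ hden0, hP, hQ, hR]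
  ring
end

section
/- The real number x = (1/2)·( -5 + √13 + 2·√(26 - 6√13)·cos(π/26) ) satisfies x³ + x² - 4x + 1 = 0. -/
/-- `u = 2 * cos (π / 26)` is a root of its minimal polynomial, and two cosine sums, which equal
`√13` and `√(26 - 6 * √13)`, are polynomials in `u`. -/
theorem two_mul_cos_pi_div_26_relations (θ u : ℝ) (hθ : θ = Real.pi / 26)
    (hu : u = 2 * Real.cos θ) :
    13 - 91 * u ^ 2 + 182 * u ^ 4 - 156 * u ^ 6 + 65 * u ^ 8 - 13 * u ^ 10 + u ^ 12 = 0 ∧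
    1 + 4 * (Real.cos (4 * θ) + Real.cos (12 * θ) - Real.cos (10 * θ)) =
      -13 + 52 * u ^ 2 - 52 * u ^ 4 + 18 * u ^ 6 - 2 * u ^ 8 ∧
    4 * (Real.cos θ + Real.cos (9 * θ) - Real.cos (3 * θ)) =
      26 * u - 62 * u ^ 3 + 54 * u ^ 5 - 18 * u ^ 7 + 2 * u ^ 9 := by
  have step (x : ℝ) : 2 * Real.cos (x + θ) = u * (2 * Real.cos x) - 2 * Real.cos (x - θ) := by
    rw [hu, Real.cos_add, Real.cos_sub]
    ring
  have h2 : 2 * Real.cos (2 * θ) = -2 + u ^ 2 := by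
    have h := step (1 * θ)
    rw [show 1 * θ + θ = 2 * θ by ring, show 1 * θ - θ = 0 * θ by ring, one_mul, ← hu, zero_mul,
        Real.cos_zero] at h
    rw [h]
    ring
  have h3 : 2 * Real.cos (3 * θ) = -3 * u + u ^ 3 := by
    have h := step (2 * θ)
    rw [show 2 * θ + θ = 3 * θ by ring, show 2 * θ - θ = 1 * θ by ring, h2, one_mul, ← hu] at h
    rw [h]
    ring
  have h4 : 2 * Real.cos (4 * θ) = 2 - 4 * u ^ 2 + u ^ 4 := by
    have h := step (3 * θ)
    rw [show 3 * θ + θ = 4 * θ by ring, show 3 * θ - θ = 2 * θ by ring, h3, h2] at h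
    rw [h]
    ring
  have h5 : 2 * Real.cos (5 * θ) = 5 * u - 5 * u ^ 3 + u ^ 5 := by
    have h := step (4 * θ)
    rw [show 4 * θ + θ = 5 * θ by ring, show 4 * θ - θ = 3 * θ by ring, h4, h3] at h
    rw [h]
    ring
  have h6 : 2 * Real.cos (6 * θ) = -2 + 9 * u ^ 2 - 6 * u ^ 4 + u ^ 6 := by
    have h := step (5 * θ)
    rw [show 5 * θ + θ = 6 * θ by ring, show 5 * θ - θ = 4 * θ by ring, h5, h4] at h
    rw [h]
    ring
  have h7 : 2 * Real.cos (7 * θ) = -7 * u + 14 * u ^ 3 - 7 * u ^ 5 + u ^ 7 := by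
    have h := step (6 * θ)
    rw [show 6 * θ + θ = 7 * θ by ring, show 6 * θ - θ = 5 * θ by ring, h6, h5] at h
    rw [h]
    ring
  have h8 : 2 * Real.cos (8 * θ) = 2 - 16 * u ^ 2 + 20 * u ^ 4 - 8 * u ^ 6 + u ^ 8 := by
    have h := step (7 * θ)
    rw [show 7 * θ + θ = 8 * θ by ring, show 7 * θ - θ = 6 * θ by ring, h7, h6] at h
    rw [h]
    ring
  have h9 : 2 * Real.cos (9 * θ) = 9 * u - 30 * u ^ 3 + 27 * u ^ 5 - 9 * u ^ 7 + u ^ 9 := by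
    have h := step (8 * θ)
    rw [show 8 * θ + θ = 9 * θ by ring, show 8 * θ - θ = 7 * θ by ring, h8, h7] at h
    rw [h]
    ring
  have h10 : 2 * Real.cos (10 * θ) = -2 + 25 * u ^ 2 - 50 * u ^ 4 + 35 * u ^ 6 - 10 * u ^ 8 +
      u ^ 10 := by
    have h := step (9 * θ)
    rw [show 9 * θ + θ = 10 * θ by ring, show 9 * θ - θ = 8 * θ by ring, h9, h8] at h
    rw [h]
    ring
  have h11 : 2 * Real.cos (11 * θ) = -11 * u + 55 * u ^ 3 - 77 * u ^ 5 + 44 * u ^ 7 - 11 * u ^ 9 +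
      u ^ 11 := by
    have h := step (10 * θ)
    rw [show 10 * θ + θ = 11 * θ by ring, show 10 * θ - θ = 9 * θ by ring, h10, h9] at h
    rw [h]
    ring
  have h12 : 2 * Real.cos (12 * θ) = 2 - 36 * u ^ 2 + 105 * u ^ 4 - 112 * u ^ 6 + 54 * u ^ 8 -
      12 * u ^ 10 + u ^ 12 := by
    have h := step (11 * θ)
    rw [show 11 * θ + θ = 12 * θ by ring, show 11 * θ - θ = 10 * θ by ring, h11, h10] at h
    rw [h]
    ring
  have h13 : 2 * Real.cos (13 * θ) = 13 * u - 91 * u ^ 3 + 182 * u ^ 5 - 156 * u ^ 7 +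
      65 * u ^ 9 - 13 * u ^ 11 + u ^ 13 := by
    have h := step (12 * θ)
    rw [show 12 * θ + θ = 13 * θ by ring, show 12 * θ - θ = 11 * θ by ring, h12, h11] at h
    rw [h]
    ring
  have hzero : Real.cos (13 * θ) = 0 := by
    rw [hθ, show 13 * (Real.pi / 26) = Real.pi / 2 by ring, Real.cos_pi_div_two]
  have hu0 : u ≠ 0 := by
    have : 0 < Real.cos θ := Real.cos_pos_of_mem_Ioo ⟨by linarith [Real.pi_pos], by
      linarith [Real.pi_pos]⟩
    rw [hu]
    positivity
  have hP : 13 - 91 * u ^ 2 + 182 * u ^ 4 - 156 * u ^ 6 + 65 * u ^ 8 - 13 * u ^ 10 + u ^ 12 =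
      0 := by
    apply mul_left_cancel₀ hu0
    linear_combination 2 * hzero - h13
  refine ⟨hP, ?_, ?_⟩
  · linear_combination 2 * h4 + 2 * h12 - 2 * h10 + 2 * hP
  · linear_combination 2 * h9 - 2 * h3 - 2 * hu

theorem stmt_16 :
    let x : ℝ := (1 / 2) *
      (-5 + Real.sqrt 13 + 2 * Real.sqrt (26 - 6 * Real.sqrt 13) * Real.cos (Real.pi / 26))
    x ^ 3 + x ^ 2 - 4 * x + 1 = 0 := by
  intro x
  obtain ⟨θ, hθ⟩ : ∃ θ : ℝ, θ = Real.pi / 26 := ⟨_, rfl⟩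
  obtain ⟨u, hu⟩ : ∃ u : ℝ, u = 2 * Real.cos θ := ⟨_, rfl⟩
  obtain ⟨hP, hS, hR⟩ := two_mul_cos_pi_div_26_relations θ u hθ hu
  have hpi := Real.pi_pos
  have hs : Real.sqrt 13 = -13 + 52 * u ^ 2 - 52 * u ^ 4 + 18 * u ^ 6 - 2 * u ^ 8 := by
    rw [Real.sqrt_eq_iff_mul_self_eq (by norm_num)]
    · linear_combination -(12 - 20 * u ^ 2 + 4 * u ^ 4) * hP
    · have h1 : 0 ≤ Real.cos (12 * θ) :=
        Real.cos_nonneg_of_mem_Icc ⟨by linarith, by linarith⟩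
      have h2 : Real.cos (10 * θ) ≤ Real.cos (4 * θ) :=
        Real.cos_le_cos_of_nonneg_of_le_pi (by linarith) (by linarith) (by linarith)
      linarith
  have hr : Real.sqrt (26 - 6 * Real.sqrt 13) = 26 * u - 62 * u ^ 3 + 54 * u ^ 5 - 18 * u ^ 7 +
      2 * u ^ 9 := by
    have hsq : 26 - 6 * Real.sqrt 13 = (26 * u - 62 * u ^ 3 + 54 * u ^ 5 - 18 * u ^ 7 +
        2 * u ^ 9) ^ 2 := by
      rw [hs]
      linear_combination -(-8 + 20 * u ^ 2 - 20 * u ^ 4 + 4 * u ^ 6) * hP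
    rw [hsq, Real.sqrt_sq]
    have h1 : 0 ≤ Real.cos (9 * θ) :=
      Real.cos_nonneg_of_mem_Icc ⟨by linarith, by linarith⟩
    have h2 : Real.cos (3 * θ) ≤ Real.cos θ :=
      Real.cos_le_cos_of_nonneg_of_le_pi (by linarith) (by linarith) (by linarith)
    linarith
  have hx : 2 * x = -18 + 78 * u ^ 2 - 114 * u ^ 4 + 72 * u ^ 6 - 20 * u ^ 8 + 2 * u ^ 10 := by
    have h : 2 * x = -5 + Real.sqrt 13 + Real.sqrt (26 - 6 * Real.sqrt 13) * u := by
      simp only [x, hu, hθ]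
      ring
    rw [h, hr, hs]
    ring
  have hcubic : (2 * x) ^ 3 + 2 * (2 * x) ^ 2 - 16 * (2 * x) + 8 = 0 := by
    rw [hx]
    linear_combination (-376 + 2672 * u ^ 2 - 8120 * u ^ 4 + 13776 * u ^ 6 - 14272 * u ^ 8 +
        9352 * u ^ 10 - 3872 * u ^ 12 + 976 * u ^ 14 - 136 * u ^ 16 + 8 * u ^ 18) * hP
  linear_combination hcubic / 8
end
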